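/- As t → ∞, μ₃(t)/s(t)³ → 0, i.e., the skewness of the tilted density tends to zero. -/

import Mathlib

open Real Filter Topology MeasureTheory Set

noncomputable section

/-- A representation of a function `l` in class `R₀`:
`l x = exp (∫_1^x ε u / u du)` for `x ≥ 1`, where `ε` is twice differentiable
(with first and second derivatives `ε'`, `ε''`) and `ε x → 0` as `x → ∞`. -/
def IsR0Rep (l ε ε' ε'' : ℝ → ℝ) : Prop :=
  (∀ x, HasDerivAt ε (ε' x) x) ∧ (∀ x, HasDerivAt ε' (ε'' x) x) ∧
    Tendsto ε atTop (𝓝 0) ∧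
    ∀ x ≥ (1 : ℝ), l x = Real.exp (∫ u in (1:ℝ)..x, ε u / u)

/-- The generalized inverse `ψ u = inf {x | h x ≥ u}` of `h`. -/
def geninv (h : ℝ → ℝ) (u : ℝ) : ℝ := sInf {x : ℝ | u ≤ h x}

/-- Class `R_β` (`β > 0`): `h x = x ^ β * l x` for large `x`, with `l ∈ R₀` whose
representing `ε` satisfies `limsup x * |ε' x| < ∞` and `limsup x ^ 2 * |ε'' x| < ∞`. -/
def MemRbeta (h : ℝ → ℝ) (β : ℝ) : Prop :=
  0 < β ∧ ∃ l ε ε' ε'' : ℝ → ℝ, IsR0Rep l ε ε' ε'' ∧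
    (∀ᶠ x in atTop, h x = x ^ β * l x) ∧
    (∃ C : ℝ, ∀ᶠ x in atTop, x * |ε' x| ≤ C) ∧
    (∃ C : ℝ, ∀ᶠ x in atTop, x ^ (2 : ℕ) * |ε'' x| ≤ C)

/-- Class `R_∞`: `h` is increasing and strictly monotone and its generalized inverse
`ψ` satisfies `ψ x = exp (∫_1^x ε u / u du)` with `ψ x → ∞`, `x ε' x / ε x → 0`,
`x ^ 2 ε'' x / ε x → 0` and `liminf x ^ η * ε x > 0` for some `η ∈ (0, 1/4)`. -/
def MemRinfty (h : ℝ → ℝ) : Prop :=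
  StrictMonoOn h (Set.Ici 0) ∧
  ∃ ε ε' ε'' : ℝ → ℝ,
    (∀ x, HasDerivAt ε (ε' x) x) ∧ (∀ x, HasDerivAt ε' (ε'' x) x) ∧
    (∀ x ≥ (1 : ℝ), geninv h x = Real.exp (∫ u in (1:ℝ)..x, ε u / u)) ∧
    Tendsto (geninv h) atTop atTop ∧
    Tendsto (fun x => x * ε' x / ε x) atTop (𝓝 0) ∧
    Tendsto (fun x => x ^ (2 : ℕ) * ε'' x / ε x) atTop (𝓝 0) ∧
    ∃ η : ℝ, η ∈ Set.Ioo (0 : ℝ) (1/4) ∧ ∃ c > (0 : ℝ), ∀ᶠ x in atTop, c ≤ x ^ η * ε x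

/-- The class `𝔯 = R_β ∪ R_∞`. -/
def MemFrakR (h : ℝ → ℝ) : Prop := (∃ β : ℝ, MemRbeta h β) ∨ MemRinfty h

/-- The moment generating function `Φ t = ∫_0^∞ e^{t x} p x dx`. -/
def mgfFun (p : ℝ → ℝ) (t : ℝ) : ℝ := ∫ x in Set.Ici (0:ℝ), Real.exp (t * x) * p x

/-- `m = (log Φ)'`, the mean of the tilted density. -/
def mFun (p : ℝ → ℝ) : ℝ → ℝ := deriv fun t => Real.log (mgfFun p t)

/-- `s² = m'`, the variance of the tilted density. -/
def s2Fun (p : ℝ → ℝ) : ℝ → ℝ := deriv (mFun p)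

/-- `μ₃ = (log Φ)'''`, the third centered moment of the tilted density. -/
def mu3Fun (p : ℝ → ℝ) : ℝ → ℝ := deriv (s2Fun p)

/-- Regular growth of `h` at infinity: `x * h' x / h x = 1 / e x` with a positive, slowly
changing `e` that is neither too small nor too large compared with `x * h x`. -/
structure RegularGrowth (h e e' : ℝ → ℝ) : Prop where
  pos : ∀ᶠ x in atTop, 0 < e x
  hasDerivAt_h : ∀ᶠ x in atTop, HasDerivAt h (h x / (x * e x)) x
  hasDerivAt_e : ∀ᶠ x in atTop, HasDerivAt e (e' x) x
  bounded : ∃ C : ℝ, ∀ᶠ x in atTop, |x * e' x| ≤ C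
  tendsto_h : Tendsto h atTop atTop
  tendsto_mul : Tendsto (fun x => x * h x * e x) atTop atTop
  tendsto_div : Tendsto (fun x => x * h x / e x) atTop atTop

/-- The natural length scale `1 / √(h' x)` of the tilted density with mode `x`. -/
def tiltScale (h e : ℝ → ℝ) (x : ℝ) : ℝ := √(x * e x / h x)

/-- The first-order Taylor remainder `g z - g x - h x * (z - x)`, where `h = g'`. -/
def taylorGap (g h : ℝ → ℝ) (x z : ℝ) : ℝ := g z - g x - h x * (z - x)

lemma tendsto_inv_sqrt_atTop {f : ℝ → ℝ} (hf : Tendsto f atTop atTop) :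
    Tendsto (fun x => (√(f x))⁻¹) atTop (𝓝 0) :=
  tendsto_inv_atTop_zero.comp (tendsto_sqrt_atTop.comp hf)

namespace RegularGrowth

variable {h e e' : ℝ → ℝ}

lemma eventually_pos (H : RegularGrowth h e e') :
    ∀ᶠ x in atTop, 0 < x ∧ 0 < h x ∧ 0 < e x := by
  filter_upwards [eventually_gt_atTop 0, H.tendsto_h.eventually_gt_atTop 0, H.pos] with x h1 h2 h3
  exact ⟨h1, h2, h3⟩

lemma tiltScale_pos (H : RegularGrowth h e e') : ∀ᶠ x in atTop, 0 < tiltScale h e x := by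
  filter_upwards [H.eventually_pos] with x ⟨h1, h2, h3⟩
  unfold tiltScale; positivity

lemma tendsto_tiltScale_div (H : RegularGrowth h e e') :
    Tendsto (fun x => tiltScale h e x / x) atTop (𝓝 0) := by
  refine (tendsto_inv_sqrt_atTop H.tendsto_div).congr' ?_
  filter_upwards [H.eventually_pos] with x ⟨h1, h2, h3⟩
  unfold tiltScale
  calc (√(x * h x / e x))⁻¹ = √(x * e x / h x / x ^ 2) := by
        rw [← Real.sqrt_inv]; congr 1; field_simp
    _ = √(x * e x / h x) / x := by rw [Real.sqrt_div (by positivity), Real.sqrt_sq h1.le]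

lemma tendsto_mul_tiltScale (H : RegularGrowth h e e') :
    Tendsto (fun x => h x * tiltScale h e x) atTop atTop := by
  refine (tendsto_sqrt_atTop.comp H.tendsto_mul).congr' ?_
  filter_upwards [H.eventually_pos] with x ⟨h1, h2, h3⟩
  unfold tiltScale
  calc √(x * h x * e x) = √(h x ^ 2 * (x * e x / h x)) := by congr 1; field_simp
    _ = h x * √(x * e x / h x) := by rw [Real.sqrt_mul (by positivity), Real.sqrt_sq h2.le]

lemma tendsto_id_mul (H : RegularGrowth h e e') :
    Tendsto (fun x => x * h x) atTop atTop :=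
  tendsto_id.atTop_mul_atTop₀ H.tendsto_h

lemma hasDerivAt_tiltScale (H : RegularGrowth h e e') :
    ∃ σ' : ℝ → ℝ, Tendsto σ' atTop (𝓝 0) ∧
      ∀ᶠ x in atTop, HasDerivAt (tiltScale h e) (σ' x) x := by
  refine ⟨fun x => (1 / 2) * ((√(x * h x / e x))⁻¹ + (x * e' x - 1) * (√(x * h x * e x))⁻¹),
    ?_, ?_⟩
  · obtain ⟨C, hC⟩ := H.bounded
    have hb : Tendsto (fun x => (x * e' x - 1) * (√(x * h x * e x))⁻¹) atTop (𝓝 0) := by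
      have := (tendsto_inv_sqrt_atTop H.tendsto_mul).const_mul (C + 1)
      rw [mul_zero] at this
      refine squeeze_zero_norm' ?_ this
      filter_upwards [hC] with x hx
      rw [norm_mul, Real.norm_eq_abs, Real.norm_eq_abs, abs_of_nonneg (a := (√_)⁻¹) (by positivity)]
      gcongr
      exact (abs_sub _ _).trans (by simpa using hx)
    simpa only [add_zero, mul_zero] using
      ((tendsto_inv_sqrt_atTop H.tendsto_div).add hb).const_mul (1 / 2)
  · filter_upwards [H.eventually_pos, H.hasDerivAt_h, H.hasDerivAt_e] with x ⟨h1, h2, h3⟩ dh de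
    have hd := (((hasDerivAt_id x).mul de).div dh h2.ne').sqrt
      (show x * e x / h x ≠ 0 by positivity)
    refine hd.congr_deriv ?_
    simp only [id, Pi.mul_apply, Pi.div_apply]
    have e1 : √(x * e x / h x) = √(x * h x * e x) / h x := by
      rw [← Real.sqrt_sq h2.le, ← Real.sqrt_div (by positivity), Real.sqrt_sq h2.le]
      congr 1; field_simp
    have e2 : √(x * h x / e x) = √(x * h x * e x) / e x := by
      rw [← Real.sqrt_sq h3.le, ← Real.sqrt_div (by positivity), Real.sqrt_sq h3.le]
      congr 1; field_simp
    have hs : 0 < √(x * h x * e x) := by positivity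
    rw [e1, e2]
    field_simp
    ring

/-- The length scale is asymptotically constant on windows of its own size. -/
lemma eventually_abs_tiltScale_ratio (H : RegularGrowth h e e') {L ρ : ℝ} (hL : 0 < L)
    (hρ : 0 < ρ) : ∀ᶠ x in atTop, ∀ z, |z| ≤ L →
      |tiltScale h e (x + tiltScale h e x * z) / tiltScale h e x - 1| ≤ ρ := by
  obtain ⟨σ', hσ', hd⟩ := H.hasDerivAt_tiltScale
  have hsmall : ∀ᶠ x in atTop, |σ' x| ≤ ρ / L := by
    have := hσ'.eventually (Metric.closedBall_mem_nhds 0 (div_pos hρ hL))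
    filter_upwards [this] with x hx using by simpa using hx
  obtain ⟨X, hX⟩ := eventually_atTop.1 (hd.and hsmall)
  have hdiv : ∀ᶠ x in atTop, tiltScale h e x / x < 1 / (2 * L) :=
    H.tendsto_tiltScale_div.eventually_lt_const (by positivity)
  filter_upwards [hdiv, H.tiltScale_pos, eventually_gt_atTop 0, eventually_ge_atTop (2 * X)]
    with x h1 h2 h3 h4 z hz
  set s := tiltScale h e x
  have h5 : s * L < x / 2 := by
    rw [div_lt_div_iff₀ h3 (by positivity)] at h1; linarith
  have h6 : |s * z| ≤ s * L := by rw [abs_mul, abs_of_pos h2]; gcongr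
  have h7 := abs_le.1 h6
  have key := Convex.norm_image_sub_le_of_norm_hasDerivWithin_le (f := tiltScale h e) (f' := σ')
    (s := Ici X) (x := x) (y := x + s * z) (C := ρ / L)
    (fun w hw => (hX w hw).1.hasDerivWithinAt) (fun w hw => (hX w hw).2) (convex_Ici X)
    (by simp only [mem_Ici]; linarith) (by simp only [mem_Ici]; linarith)
  have : tiltScale h e (x + s * z) / s - 1 = (tiltScale h e (x + s * z) - s) / s := by
    field_simp
  rw [this, abs_div, abs_of_pos h2, div_le_iff₀ h2]
  simp only [Real.norm_eq_abs, add_sub_cancel_left] at key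
  calc _ ≤ _ := key
    _ ≤ ρ / L * (s * L) := by gcongr
    _ = ρ * s := by field_simp

lemma eventually_abs_rescaled_deriv (H : RegularGrowth h e e') {L δ : ℝ} (hL : 0 < L)
    (hδ : 0 < δ) : ∀ᶠ x in atTop, ∀ z, |z| ≤ L →
      HasDerivAt h (1 / tiltScale h e (x + tiltScale h e x * z) ^ 2)
        (x + tiltScale h e x * z) ∧
      |tiltScale h e x ^ 2 * (1 / tiltScale h e (x + tiltScale h e x * z) ^ 2) - 1| ≤ δ := by
  have hc : ContinuousAt (fun r : ℝ => 1 / r ^ 2) 1 :=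
    ContinuousAt.div continuousAt_const (by fun_prop) (by norm_num)
  obtain ⟨ρ, hρ, hρδ⟩ := Metric.continuousAt_iff.1 hc δ hδ
  have hdiv : ∀ᶠ x in atTop, tiltScale h e x / x < 1 / (2 * L) :=
    H.tendsto_tiltScale_div.eventually_lt_const (by positivity)
  obtain ⟨X, hX⟩ := eventually_atTop.1 (H.eventually_pos.and H.hasDerivAt_h)
  filter_upwards [hdiv, H.tiltScale_pos, eventually_gt_atTop 0, eventually_ge_atTop (2 * X),
    H.eventually_abs_tiltScale_ratio hL (half_pos hρ)] with x h1 h2 h3 h4 h8 z hz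
  specialize h8 z hz
  set s := tiltScale h e x
  have h5 : s * L < x / 2 := by
    rw [div_lt_div_iff₀ h3 (by positivity)] at h1; linarith
  have h6 : |s * z| ≤ s * L := by rw [abs_mul, abs_of_pos h2]; gcongr
  have h7 := abs_le.1 h6
  obtain ⟨⟨k1, k2, k3⟩, k4⟩ := hX (x + s * z) (by linarith)
  constructor
  · convert k4 using 1
    rw [tiltScale, Real.sq_sqrt (by positivity), one_div_div]
  · have := hρδ (x := tiltScale h e (x + s * z) / s) (by rw [Real.dist_eq]; linarith)
    rw [Real.dist_eq] at this
    refine le_of_eq_of_le ?_ this.le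
    rw [div_pow, one_div_div]
    norm_num [div_eq_mul_inv]

/-- At its natural scale the Taylor gap is asymptotically quadratic. -/
lemma tendsto_taylorGap (H : RegularGrowth h e e') {g : ℝ → ℝ} (hg : ∀ x, HasDerivAt g (h x) x)
    (y : ℝ) : Tendsto (fun x => taylorGap g h x (x + tiltScale h e x * y)) atTop
      (𝓝 (y ^ 2 / 2)) := by
  rw [Metric.tendsto_atTop']
  intro ε hε
  have hL : 0 < |y| + 1 := by positivity
  set L := |y| + 1
  have hev := H.eventually_abs_rescaled_deriv hL (δ := ε / (2 * L ^ 2)) (by positivity)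
  obtain ⟨X, hX⟩ := eventually_atTop.1 hev
  refine ⟨X, fun x hx => ?_⟩
  specialize hX x hx.le
  set s := tiltScale h e x
  have hin : ∀ z : ℝ, HasDerivAt (fun z => x + s * z) s z := fun z => by
    simpa using ((hasDerivAt_id z).const_mul s).const_add x
  have hyL : y ∈ Icc (-L) L := abs_le.1 (by simp [L])
  have h0L : (0 : ℝ) ∈ Icc (-L) L := ⟨by linarith, by linarith⟩
  have first : ∀ z ∈ Icc (-L) L, |s * (h (x + s * z) - h x) - z| ≤ ε / (2 * L ^ 2) * L := by
    intro z hz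
    have key := Convex.norm_image_sub_le_of_norm_hasDerivWithin_le
      (f := fun z => s * (h (x + s * z) - h x) - z)
      (f' := fun z => s ^ 2 * (1 / tiltScale h e (x + s * z) ^ 2) - 1)
      (s := Icc (-L) L) (x := 0) (y := z) (C := ε / (2 * L ^ 2))
      (fun w hw => by
        have := ((((hX w (abs_le.2 hw)).1.comp w (hin w)).sub_const (h x)).const_mul s).sub
          (hasDerivAt_id w)
        refine (this.congr_deriv ?_).hasDerivWithinAt
        ring)
      (fun w hw => (hX w (abs_le.2 hw)).2) (convex_Icc _ _) h0L hz
    simp only [mul_zero, add_zero, sub_self, sub_zero, Real.norm_eq_abs] at key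
    exact key.trans (by gcongr; exact abs_le.2 hz)
  have key := Convex.norm_image_sub_le_of_norm_hasDerivWithin_le
    (f := fun z => taylorGap g h x (x + s * z) - z ^ 2 / 2)
    (f' := fun z => s * (h (x + s * z) - h x) - z)
    (s := Icc (-L) L) (x := 0) (y := y) (C := ε / (2 * L ^ 2) * L)
    (fun w hw => by
      have h1 := ((hg (x + s * w)).comp w (hin w)).sub_const (g x)
      have h2 := ((hin w).sub_const x).const_mul (h x)
      have := (h1.sub h2).sub (((hasDerivAt_id w).pow 2).div_const 2)
      refine (this.congr_deriv ?_).hasDerivWithinAt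
      simp; ring)
    first (convex_Icc _ _) h0L hyL
  simp only [taylorGap, mul_zero, add_zero, sub_self, sub_zero, Real.norm_eq_abs] at key
  norm_num at key
  rw [Real.dist_eq]
  unfold taylorGap
  rw [add_sub_cancel_left]
  calc _ ≤ _ := key
    _ ≤ ε / (2 * L ^ 2) * L * L := by gcongr; exact abs_le.2 hyL
    _ = ε / 2 := by field_simp
    _ < ε := by linarith

lemma exists_convexOn (H : RegularGrowth h e e') {g : ℝ → ℝ} (hg : ∀ x, HasDerivAt g (h x) x) :
    ∃ X > 0, ConvexOn ℝ (Ici X) g := by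
  obtain ⟨X, hX⟩ := eventually_atTop.1 (H.eventually_pos.and H.hasDerivAt_h)
  refine ⟨max X 1, by positivity, ?_⟩
  have hd : deriv g = h := funext fun x => (hg x).deriv
  have hX' : ∀ x ∈ Ici (max X 1), X ≤ x := fun x hx => (le_max_left _ _).trans hx
  have hm : MonotoneOn h (Ici (max X 1)) := by
    refine monotoneOn_of_deriv_nonneg (convex_Ici _)
      (fun x hx => (hX x (hX' x hx)).2.continuousAt.continuousWithinAt)
      (fun x hx => (hX x (hX' x (interior_subset hx))).2.differentiableAt.differentiableWithinAt)
      fun x hx => ?_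
    obtain ⟨⟨h1, h2, h3⟩, h4⟩ := hX x (hX' x (interior_subset hx))
    rw [h4.deriv]; positivity
  refine MonotoneOn.convexOn_of_deriv (convex_Ici _)
    (fun x _ => (hg x).continuousAt.continuousWithinAt)
    (fun x _ => (hg x).differentiableAt.differentiableWithinAt) ?_
  rw [hd]
  exact hm.mono interior_subset

/-- The Taylor gap grows at least linearly at its natural scale, uniformly on the half-line. -/
lemma eventually_le_taylorGap (H : RegularGrowth h e e') {g : ℝ → ℝ}
    (hg : ∀ x, HasDerivAt g (h x) x) (hg0 : ∀ x ≥ 0, 0 < g x) :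
    ∀ᶠ x in atTop, ∀ z ≥ 0, |z - x| / (2 * tiltScale h e x) - 1 ≤ taylorGap g h x z := by
  obtain ⟨X, hX0, hconv⟩ := H.exists_convexOn hg
  have hr := (H.tendsto_taylorGap hg 2).eventually_const_le (u := 1) (by norm_num)
  have hl := (H.tendsto_taylorGap hg (-2)).eventually_const_le (u := 1) (by norm_num)
  have hdiv : ∀ᶠ x in atTop, tiltScale h e x / x < 1 / 4 :=
    H.tendsto_tiltScale_div.eventually_lt_const (by positivity)
  filter_upwards [hr, hl, hdiv, H.tiltScale_pos, H.tendsto_mul_tiltScale.eventually_ge_atTop 1,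
    H.tendsto_h.eventually_ge_atTop (2 * g (X + 1)), eventually_ge_atTop (2 * (X + 1))]
    with x hr hl hdiv hs hhs hgX hxX
  set s := tiltScale h e x
  have hx0 : 0 < x := by linarith
  rw [div_lt_div_iff₀ hx0 (by norm_num)] at hdiv
  have hxm : x ∈ Ici X := by simp only [mem_Ici]; linarith
  have main : ∀ z ∈ Ici X, |z - x| / (2 * s) - 1 ≤ taylorGap g h x z := by
    intro z hz
    have nonneg : 0 ≤ taylorGap g h x z := by
      unfold taylorGap
      rcases lt_trichotomy z x with hzx | rfl | hzx
      · have := hconv.slope_le_of_hasDerivAt hz hxm hzx (hg x)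
        rw [slope_def_field, div_le_iff₀ (by linarith)] at this
        linarith
      · simp
      · have := hconv.le_slope_of_hasDerivAt hxm hz hzx (hg x)
        rw [slope_def_field, le_div_iff₀ (by linarith)] at this
        linarith
    unfold taylorGap at *
    rcases le_or_gt (|z - x|) (2 * s) with hnear | hfar
    · have : |z - x| / (2 * s) ≤ 1 := (div_le_one (by positivity)).2 hnear
      linarith
    suffices |z - x| / (2 * s) ≤ g z - g x - h x * (z - x) by linarith
    rcases lt_abs.1 hfar with hz' | hz'
    · have hw : x + s * 2 ∈ Ici X := by simp only [mem_Ici] at *; linarith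
      have := hconv.secant_mono hxm hw hz (by linarith) (by linarith) (by linarith)
      have h1 : h x + 1 / (2 * s) ≤ (g (x + s * 2) - g x) / (x + s * 2 - x) := by
        rw [le_div_iff₀ (by linarith), add_sub_cancel_left] at *
        have : 1 / (2 * s) * (s * 2) = 1 := by field_simp
        linarith
      have h2 := h1.trans this
      rw [le_div_iff₀ (by linarith)] at h2
      rw [abs_of_pos (by linarith)]
      have : 1 / (2 * s) * (z - x) = (z - x) / (2 * s) := by ring
      linarith
    · have hw : x + s * (-2) ∈ Ici X := by simp only [mem_Ici] at *; linarith
      have := hconv.secant_mono hxm hz hw (by linarith) (by linarith) (by linarith)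
      have h1 : (g (x + s * (-2)) - g x) / (x + s * (-2) - x) ≤ h x - 1 / (2 * s) := by
        rw [div_le_iff_of_neg (by linarith), add_sub_cancel_left] at *
        have : 1 / (2 * s) * (s * (-2)) = -1 := by field_simp
        linarith
      have h2 := this.trans h1
      rw [div_le_iff_of_neg (by linarith)] at h2
      rw [abs_of_neg (by linarith)]
      have : 1 / (2 * s) * (z - x) = -(-(z - x) / (2 * s)) := by ring
      linarith
  intro z hz
  rcases le_or_gt X z with hzX | hzX
  · exact main z hzX
  have h1 := main (X + 1) (by simp)
  have h2 := hg0 z hz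
  have h3 := hg0 (X + 1) (by linarith)
  unfold taylorGap at *
  rw [abs_of_neg (by linarith)] at *
  have h4 : 1 / (2 * s) ≤ h x / 2 := by
    rw [div_le_div_iff₀ (by positivity) (by norm_num)]; linarith
  have h5 : 1 / (2 * s) * (X + 1 - z) ≤ h x / 2 * (X + 1 - z) := by gcongr; linarith
  have h6 : -(z - x) / (2 * s) = -(X + 1 - x) / (2 * s) + 1 / (2 * s) * (X + 1 - z) := by ring
  have h7 : g (X + 1) * 1 ≤ h x / 2 * (X + 1 - z) := by gcongr <;> linarith
  linarith

end RegularGrowth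

/-- The `j`-th moment of the tilted density about `x`, in units of the natural length scale at
`x` and up to a normalization which does not depend on `j`. -/
def scaledMoment (p g h e : ℝ → ℝ) (j : ℕ) (x : ℝ) : ℝ :=
  (tiltScale h e x)⁻¹ *
    ∫ z, ((z - x) / tiltScale h e x) ^ j * (exp (h x * (z - x) + g x) * p z)

lemma exp_mul_eq_exp_neg_taylorGap (p g h : ℝ → ℝ) (x z : ℝ) :
    exp (h x * (z - x) + g x) * p z = exp (-taylorGap g h x z) * (exp (g z) * p z) := by
  rw [← mul_assoc, ← exp_add]
  congr 2
  unfold taylorGap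
  ring

lemma pow_mul_exp_neg_half_le (n : ℕ) {u : ℝ} (hu : 0 ≤ u) :
    u ^ n * exp (-(u / 2)) ≤ 2 ^ n * n.factorial := by
  have := Real.pow_div_factorial_le_exp (u / 2) (by positivity) n
  rw [div_le_iff₀ (by positivity), div_pow, div_le_iff₀ (by positivity)] at this
  rw [exp_neg, ← div_eq_mul_inv, div_le_iff₀ (exp_pos _)]
  linarith

lemma integrable_abs_pow_mul_exp_neg_half_abs (n : ℕ) :
    Integrable fun y : ℝ => |y| ^ n * exp (-(|y| / 2)) := by
  have h0 : IntegrableOn (fun y : ℝ => |y| ^ n * exp (-(|y| / 2))) (Ioi 0) := by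
    refine (integrableOn_rpow_mul_exp_neg_mul_rpow (s := n) (p := 1) (b := 1 / 2)
      (by linarith [(Nat.cast_nonneg n : (0 : ℝ) ≤ n)]) one_pos (by norm_num)).congr_fun
      (fun y hy => ?_) measurableSet_Ioi
    rw [mem_Ioi] at hy
    simp only [abs_of_pos hy, rpow_one, rpow_natCast]
    congr 2
    ring
  rw [← integrableOn_univ, ← Iic_union_Ioi (a := (0 : ℝ)), integrableOn_union]
  refine ⟨?_, h0⟩
  have h1 : IntegrableOn (fun y : ℝ => |y| ^ n * exp (-(|y| / 2))) (Ici (-0)) := by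
    rw [neg_zero]
    exact (integrableOn_Ici_iff_integrableOn_Ioi (by simp)).2 h0
  have h2 := h1.comp_neg_Iic
  simp only [abs_neg] at h2
  exact h2

section Moments

variable {p g q h e e' : ℝ → ℝ} {c : ℝ}

lemma exp_mul_density (hpdef : ∀ x ≥ (0 : ℝ), p x = c * exp (-(g x - q x))) {z : ℝ}
    (hz : 0 ≤ z) : exp (g z) * p z = c * exp (q z) := by
  rw [hpdef z hz, mul_left_comm, ← exp_add]
  congr 2
  ring

lemma integrableOn_exp_mul_density (hg : Continuous g) (hpzero : ∀ x < (0 : ℝ), p x = 0)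
    (hint : Integrable fun z => exp z * p z) (X : ℝ) :
    IntegrableOn (fun z => exp (g z) * p z) (Iio X) := by
  have h1 : IntegrableOn (fun z => exp (g z) * p z) (Icc 0 X) := by
    have := (hint.integrableOn (s := Icc 0 X)).continuousOn_mul
      (g := fun z => exp (g z - z)) (by fun_prop) isCompact_Icc
    refine this.congr_fun (fun z _ => ?_) measurableSet_Icc
    simp only
    rw [← mul_assoc, ← exp_add, sub_add_cancel]
  refine h1.of_forall_sdiff_eq_zero measurableSet_Iio fun z hz => ?_
  have : z < 0 := by
    by_contra hz0
    exact hz.2 ⟨not_lt.1 hz0, hz.1.le⟩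
  simp [hpzero z this]

lemma integrable_centered_pow_mul
    (hint : ∀ t > 0, ∀ j : ℕ, Integrable fun z => z ^ j * (exp (t * z) * p z)) {t : ℝ}
    (ht : 0 < t) (x s b : ℝ) (j : ℕ) :
    Integrable fun z => ((z - x) / s) ^ j * (exp (t * (z - x) + b) * p z) := by
  have hsum : Integrable fun z => ∑ k ∈ Finset.range (j + 1),
      (s⁻¹ ^ j * exp (b - t * x) * ((-x) ^ (j - k) * j.choose k)) *
        (z ^ k * (exp (t * z) * p z)) :=
    integrable_finsetSum _ fun k _ => (hint t ht k).const_mul _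
  refine hsum.congr (ae_of_all _ fun z => ?_)
  simp only
  rw [show t * (z - x) + b = (b - t * x) + t * z by ring, exp_add, div_eq_mul_inv, mul_pow,
    sub_eq_add_neg z x, add_pow, Finset.sum_mul, Finset.sum_mul]
  refine Finset.sum_congr rfl fun k _ => ?_
  ring

namespace RegularGrowth

lemma tendsto_scaledMoment_left (H : RegularGrowth h e e') (hg : ∀ x, HasDerivAt g (h x) x)
    (hg0 : ∀ x ≥ 0, 0 < g x) (hc : 0 < c)
    (hpdef : ∀ x ≥ (0 : ℝ), p x = c * exp (-(g x - q x))) (hpzero : ∀ x < (0 : ℝ), p x = 0)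
    (hint : Integrable fun z => exp z * p z) (j : ℕ) (X : ℝ) :
    Tendsto (fun x => (tiltScale h e x)⁻¹ * ∫ z in Iio X,
      ((z - x) / tiltScale h e x) ^ j * (exp (h x * (z - x) + g x) * p z)) atTop (𝓝 0) := by
  have hgc : Continuous g := continuous_iff_continuousAt.2 fun x => (hg x).continuousAt
  have hB := integrableOn_exp_mul_density hgc hpzero hint X
  have hB0 : ∀ z, 0 ≤ exp (g z) * p z := fun z => by
    rcases lt_or_ge z 0 with hz | hz
    · simp [hpzero z hz]
    · rw [exp_mul_density hpdef hz]; positivity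
  set K : ℝ := exp 1 * (2 ^ (j + 2) * (j + 2).factorial)
  have hK : 0 ≤ K := by positivity
  have hlim := H.tendsto_tiltScale_div.const_mul (2 * K * ∫ z in Iio X, exp (g z) * p z)
  rw [mul_zero] at hlim
  refine squeeze_zero_norm' ?_ hlim
  filter_upwards [H.tiltScale_pos, H.eventually_le_taylorGap hg hg0, eventually_gt_atTop 0,
    eventually_ge_atTop (2 * X), eventually_ge_atTop (X + 1)] with x hs hgap hx0 hx2 hx1
  set s := tiltScale h e x
  rw [← integral_const_mul, mul_right_comm, ← integral_const_mul]
  refine norm_integral_le_of_norm_le (hB.const_mul _)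
    (ae_restrict_of_forall_mem measurableSet_Iio fun z hz => ?_)
  rw [mem_Iio] at hz
  rcases lt_or_ge z 0 with hz0 | hz0
  · simp [hpzero z hz0]
  rw [exp_mul_eq_exp_neg_taylorGap, norm_mul, norm_mul, norm_mul, norm_pow, norm_div,
    Real.norm_of_nonneg (hB0 z), Real.norm_of_nonneg (exp_pos _).le,
    Real.norm_of_nonneg hs.le, Real.norm_of_nonneg (inv_pos.2 hs).le, Real.norm_eq_abs]
  have hgapz := hgap z hz0
  rw [abs_of_neg (by linarith)] at *
  set u := -(z - x) / s
  have hu : 0 < u := div_pos (by linarith) hs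
  have hsu : s⁻¹ ≤ u := by
    rw [inv_eq_one_div]
    exact div_le_div_of_nonneg_right (by linarith) hs.le
  have hexp : exp (-taylorGap g h x z) ≤ exp 1 * exp (-(u / 2)) := by
    rw [← exp_add]
    gcongr
    have : -(z - x) / (2 * s) = u / 2 := by simp only [u]; field_simp
    linarith
  have hinv : u⁻¹ ≤ 2 * (s / x) := by
    simp only [u]
    rw [inv_div, mul_div_assoc', div_le_div_iff₀ (by linarith) hx0]
    have : s * x ≤ s * (2 * -(z - x)) := by gcongr; linarith
    linarith
  have hdecay := pow_mul_exp_neg_half_le (j + 2) hu.le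
  calc s⁻¹ * (u ^ j * (exp (-taylorGap g h x z) * (exp (g z) * p z)))
      ≤ u * (u ^ j * (exp 1 * exp (-(u / 2)) * (exp (g z) * p z))) := by
        have := hB0 z
        gcongr
    _ = exp 1 * (u ^ (j + 2) * exp (-(u / 2))) * u⁻¹ * (exp (g z) * p z) := by
        field_simp
        ring
    _ ≤ exp 1 * (2 ^ (j + 2) * (j + 2).factorial) * (2 * (s / x)) * (exp (g z) * p z) := by
        have := hB0 z
        gcongr
    _ = 2 * K * (s / x) * (exp (g z) * p z) := by simp only [K]; ring

lemma tendsto_scaledMoment_right (H : RegularGrowth h e e') (hg : ∀ x, HasDerivAt g (h x) x)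
    (hg0 : ∀ x ≥ 0, 0 < g x) (hc : 0 < c)
    (hpdef : ∀ x ≥ (0 : ℝ), p x = c * exp (-(g x - q x)))
    (hint : ∀ t > 0, ∀ j : ℕ, Integrable fun z => z ^ j * (exp (t * z) * p z))
    (hq : Tendsto q atTop (𝓝 0)) (j : ℕ) {X : ℝ} (hX : 0 ≤ X) (hqX : ∀ z ≥ X, q z ≤ 1) :
    Tendsto (fun x => (tiltScale h e x)⁻¹ * ∫ z in Ici X,
      ((z - x) / tiltScale h e x) ^ j * (exp (h x * (z - x) + g x) * p z)) atTop
      (𝓝 (∫ y, c * (y ^ j * exp (-(y ^ 2 / 2))))) := by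
  set F : ℝ → ℝ → ℝ := fun x => (Ici X).indicator fun z =>
    ((z - x) / tiltScale h e x) ^ j * (exp (h x * (z - x) + g x) * p z) with hF
  have hFint : ∀ᶠ x in atTop, Integrable (F x) := by
    filter_upwards [H.eventually_pos] with x ⟨_, hx, _⟩
    exact (integrable_centered_pow_mul hint hx _ _ _ _).indicator measurableSet_Ici
  have hlim : Tendsto (fun x => ∫ y, F x (x + tiltScale h e x * y)) atTop
      (𝓝 (∫ y, c * (y ^ j * exp (-(y ^ 2 / 2))))) := by
    refine tendsto_integral_filter_of_dominated_convergence
      (fun y => c * exp 2 * (|y| ^ j * exp (-(|y| / 2)))) ?_ ?_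
      ((integrable_abs_pow_mul_exp_neg_half_abs j).const_mul _) (ae_of_all _ fun y => ?_)
    · filter_upwards [hFint, H.tiltScale_pos] with x hx hs
      exact ((hx.comp_add_left x).comp_mul_left' hs.ne').aestronglyMeasurable
    · filter_upwards [H.tiltScale_pos, H.eventually_le_taylorGap hg hg0] with x hs hgap
      refine ae_of_all _ fun y => ?_
      set s := tiltScale h e x
      by_cases hz : x + s * y ∈ Ici X
      · have hz0 : 0 ≤ x + s * y := hX.trans hz
        simp only [hF, indicator_of_mem hz]
        rw [exp_mul_eq_exp_neg_taylorGap, exp_mul_density hpdef hz0, add_sub_cancel_left,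
          mul_div_cancel_left₀ _ hs.ne', norm_mul, norm_pow, Real.norm_eq_abs,
          Real.norm_of_nonneg (by positivity)]
        have h1 := hgap _ hz0
        have h2 : |x + s * y - x| / (2 * s) = |y| / 2 := by
          rw [add_sub_cancel_left, abs_mul, abs_of_pos hs]; field_simp
        calc _ ≤ |y| ^ j * (exp (1 - |y| / 2) * (c * exp 1)) := by
              gcongr
              · linarith
              · exact hqX _ hz
          _ = _ := by
              rw [show (2 : ℝ) = 1 + 1 by norm_num, exp_add, sub_eq_add_neg, exp_add]; ring
      · simp only [hF, indicator_of_notMem hz, norm_zero]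
        positivity
    · have hz : Tendsto (fun x => x + tiltScale h e x * y) atTop atTop := by
        have h1 : Tendsto (fun x => 1 + tiltScale h e x / x * y) atTop (𝓝 (1 + 0 * y)) :=
          (H.tendsto_tiltScale_div.mul_const y).const_add 1
        refine (tendsto_id.atTop_mul_pos (C := 1 + 0 * y) (by simp) h1).congr' ?_
        filter_upwards [eventually_gt_atTop 0] with x hx
        simp only [id]
        field_simp
      have hmain : Tendsto (fun x => y ^ j *
          (exp (-taylorGap g h x (x + tiltScale h e x * y)) *
            (c * exp (q (x + tiltScale h e x * y))))) atTop
          (𝓝 (y ^ j * (exp (-(y ^ 2 / 2)) * (c * exp 0)))) :=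
        (((continuous_exp.tendsto _).comp (H.tendsto_taylorGap hg y).neg).mul
          (((continuous_exp.tendsto _).comp (hq.comp hz)).const_mul c)).const_mul _
      rw [show c * (y ^ j * exp (-(y ^ 2 / 2))) = y ^ j * (exp (-(y ^ 2 / 2)) * (c * exp 0)) by
        rw [exp_zero]; ring]
      refine hmain.congr' ?_
      filter_upwards [hz.eventually_ge_atTop X, H.tiltScale_pos] with x hzX hs
      simp only [hF, indicator_of_mem (mem_Ici.2 hzX)]
      rw [exp_mul_eq_exp_neg_taylorGap, exp_mul_density hpdef (hX.trans hzX),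
        add_sub_cancel_left, mul_div_cancel_left₀ _ hs.ne']
  refine hlim.congr' ?_
  filter_upwards [H.tiltScale_pos] with x hs
  rw [Measure.integral_comp_mul_left (fun z => F x (x + z)), integral_add_left_eq_self (F x),
    abs_of_pos (inv_pos.2 hs), smul_eq_mul, integral_indicator measurableSet_Ici]

lemma tendsto_scaledMoment (H : RegularGrowth h e e') (hg : ∀ x, HasDerivAt g (h x) x)
    (hg0 : ∀ x ≥ 0, 0 < g x) (hc : 0 < c)
    (hpdef : ∀ x ≥ (0 : ℝ), p x = c * exp (-(g x - q x))) (hpzero : ∀ x < (0 : ℝ), p x = 0)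
    (hint : ∀ t > 0, ∀ j : ℕ, Integrable fun z => z ^ j * (exp (t * z) * p z))
    (hq : Tendsto q atTop (𝓝 0)) (j : ℕ) :
    Tendsto (scaledMoment p g h e j) atTop (𝓝 (∫ y, c * (y ^ j * exp (-(y ^ 2 / 2))))) := by
  obtain ⟨X₀, hX₀⟩ := eventually_atTop.1 (hq.eventually_le_const one_pos)
  have hleft := H.tendsto_scaledMoment_left hg hg0 hc hpdef hpzero
    (by simpa using hint 1 one_pos 0) j (max X₀ 0)
  have hright := H.tendsto_scaledMoment_right hg hg0 hc hpdef hint hq j (le_max_right X₀ 0)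
    fun z hz => hX₀ z ((le_max_left _ _).trans hz)
  have := hleft.add hright
  rw [zero_add] at this
  refine this.congr' ?_
  filter_upwards [H.eventually_pos] with x ⟨_, hx, _⟩
  rw [scaledMoment, ← mul_add, ← compl_Iio, integral_add_compl measurableSet_Iio
    (integrable_centered_pow_mul hint hx _ _ _ _)]

end RegularGrowth

end Moments

lemma integrable_pow_mul_exp_neg_sq (j : ℕ) :
    Integrable fun y : ℝ => y ^ j * exp (-(y ^ 2 / 2)) := by
  have := integrable_rpow_mul_exp_neg_mul_sq (b := 1 / 2) (by norm_num) (s := j)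
    (by linarith [(Nat.cast_nonneg j : (0 : ℝ) ≤ j)])
  refine this.congr (ae_of_all _ fun y => ?_)
  simp only [rpow_natCast]
  congr 2
  ring

lemma integral_pow_mul_exp_neg_sq_pos {c : ℝ} (hc : 0 < c) {j : ℕ} (hj : Even j) :
    0 < ∫ y : ℝ, c * (y ^ j * exp (-(y ^ 2 / 2))) :=
  integral_pos_of_integrable_nonneg_nonzero (x := 1) (by fun_prop)
    ((integrable_pow_mul_exp_neg_sq j).const_mul c)
    (fun y => by have := hj.pow_nonneg y; dsimp; positivity) (by positivity)

lemma integral_pow_mul_exp_neg_sq_eq_zero (c : ℝ) {j : ℕ} (hj : Odd j) :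
    ∫ y : ℝ, c * (y ^ j * exp (-(y ^ 2 / 2))) = 0 := by
  have := integral_neg_eq_self (fun y : ℝ => c * (y ^ j * exp (-(y ^ 2 / 2)))) volume
  simp only [hj.neg_pow, neg_sq, neg_mul, mul_neg, integral_neg] at this
  linarith

/-- The `j`-th unnormalized moment of the tilted density. -/
def rawMoment (p : ℝ → ℝ) (j : ℕ) (t : ℝ) : ℝ := ∫ z, z ^ j * (exp (t * z) * p z)

section RawMoments

variable {p : ℝ → ℝ}

lemma aemeasurable_and_mem_interior_integrableExpSet (hp0 : ∀ z, 0 ≤ p z)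
    (hint : ∀ t > 0, Integrable fun z => exp (t * z) * p z) :
    AEMeasurable (fun z => ENNReal.ofReal (p z)) ∧ ∀ t > 0, t ∈ interior
      (ProbabilityTheory.integrableExpSet id
        (volume.withDensity fun z => ENNReal.ofReal (p z))) := by
  have hpm : AEMeasurable p := by
    have h1 : AEMeasurable fun z => exp (-z) * (exp (1 * z) * p z) :=
      (by fun_prop : Measurable fun z : ℝ => exp (-z)).aemeasurable.mul
        (hint 1 one_pos).aestronglyMeasurable.aemeasurable
    refine h1.congr (ae_of_all _ fun z => ?_)
    simp only
    rw [← mul_assoc, ← exp_add]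
    simp
  refine ⟨hpm.ennreal_ofReal, fun t ht => ?_⟩
  refine mem_interior.2 ⟨Ioi 0, fun t ht => ?_, isOpen_Ioi, ht⟩
  rw [ProbabilityTheory.integrableExpSet, mem_ofPred_eq,
    integrable_withDensity_iff_integrable_smul₀' hpm.ennreal_ofReal (by simp)]
  refine (hint t ht).congr (ae_of_all _ fun z => ?_)
  simp [ENNReal.toReal_ofReal (hp0 z), mul_comm]

lemma integrable_pow_mul_exp_mul_density (hp0 : ∀ z, 0 ≤ p z)
    (hint : ∀ t > 0, Integrable fun z => exp (t * z) * p z) (t : ℝ) (ht : t > 0) (j : ℕ) :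
    Integrable fun z => z ^ j * (exp (t * z) * p z) := by
  obtain ⟨hm, hset⟩ := aemeasurable_and_mem_interior_integrableExpSet hp0 hint
  have := ProbabilityTheory.integrable_pow_mul_exp_of_mem_interior_integrableExpSet (hset t ht) j
  rw [integrable_withDensity_iff_integrable_smul₀' hm (by simp)] at this
  refine this.congr (ae_of_all _ fun z => ?_)
  simp only [ENNReal.toReal_ofReal (hp0 z), id, smul_eq_mul]
  ring

lemma hasDerivAt_rawMoment (hp0 : ∀ z, 0 ≤ p z)
    (hint : ∀ t > 0, Integrable fun z => exp (t * z) * p z) {t : ℝ} (ht : 0 < t) (j : ℕ) :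
    HasDerivAt (rawMoment p j) (rawMoment p (j + 1) t) t := by
  obtain ⟨hm, hset⟩ := aemeasurable_and_mem_interior_integrableExpSet hp0 hint
  have := ProbabilityTheory.hasDerivAt_integral_pow_mul_exp_real (hset t ht) j
  simp only [integral_withDensity_eq_integral_toReal_smul₀ hm (by simp : ∀ᵐ z, _ < _),
    ENNReal.toReal_ofReal (hp0 _), id, smul_eq_mul] at this
  have heq : ∀ j t, ∫ z, p z * (z ^ j * exp (t * z)) = rawMoment p j t := fun j t =>
    integral_congr_ae (ae_of_all _ fun z => by ring)
  simpa only [heq] using this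

lemma mgfFun_eq_rawMoment (hpzero : ∀ z < (0 : ℝ), p z = 0) : mgfFun p = rawMoment p 0 := by
  ext t
  simp only [mgfFun, rawMoment, pow_zero, one_mul]
  exact setIntegral_eq_integral_of_forall_compl_eq_zero fun z hz => by
    simp [hpzero z (by simpa using hz)]

lemma rawMoment_zero_pos (hp0 : ∀ z, 0 ≤ p z) (hpos : ∀ z ≥ 0, 0 < p z)
    (hint : ∀ t > 0, Integrable fun z => exp (t * z) * p z) {t : ℝ} (ht : 0 < t) :
    0 < rawMoment p 0 t := by
  simp only [rawMoment, pow_zero, one_mul]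
  rw [integral_pos_iff_support_of_nonneg (fun z => mul_nonneg (exp_pos _).le (hp0 z)) (hint t ht)]
  refine lt_of_lt_of_le (?_ : 0 < volume (Ici (0 : ℝ))) (measure_mono fun z hz => ?_)
  · simp
  · exact (mul_pos (exp_pos _) (hpos z hz)).ne'

lemma cumulants_eq (hp0 : ∀ z, 0 ≤ p z) (hpos : ∀ z ≥ 0, 0 < p z)
    (hpzero : ∀ z < (0 : ℝ), p z = 0)
    (hint : ∀ t > 0, Integrable fun z => exp (t * z) * p z) {t : ℝ} (ht : 0 < t) :
    s2Fun p t = rawMoment p 2 t / rawMoment p 0 t - (rawMoment p 1 t / rawMoment p 0 t) ^ 2 ∧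
    mu3Fun p t = rawMoment p 3 t / rawMoment p 0 t
      - 3 * (rawMoment p 2 t / rawMoment p 0 t) * (rawMoment p 1 t / rawMoment p 0 t)
      + 2 * (rawMoment p 1 t / rawMoment p 0 t) ^ 3 := by
  have hd := fun {t : ℝ} (ht : 0 < t) (j : ℕ) => hasDerivAt_rawMoment hp0 hint ht j
  have h0 := fun {t : ℝ} (ht : 0 < t) => (rawMoment_zero_pos hp0 hpos hint ht).ne'
  have hm : ∀ t > 0, mFun p t = rawMoment p 1 t / rawMoment p 0 t := fun t ht => by
    rw [mFun, mgfFun_eq_rawMoment hpzero]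
    exact ((hd ht 0).log (h0 ht)).deriv
  have hs : ∀ t > 0, s2Fun p t =
      rawMoment p 2 t / rawMoment p 0 t - (rawMoment p 1 t / rawMoment p 0 t) ^ 2 :=
    fun t ht => by
      have hev : mFun p =ᶠ[𝓝 t] rawMoment p 1 / rawMoment p 0 := by
        filter_upwards [Ioi_mem_nhds ht] with u hu using hm u hu
      rw [s2Fun, hev.deriv_eq, ((hd ht 1).div (hd ht 0) (h0 ht)).deriv]
      have := h0 ht
      field_simp
  refine ⟨hs t ht, ?_⟩
  have hev : s2Fun p =ᶠ[𝓝 t]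
      rawMoment p 2 / rawMoment p 0 - (rawMoment p 1 / rawMoment p 0) ^ 2 := by
    filter_upwards [Ioi_mem_nhds ht] with u hu using hs u hu
  have hder := ((hd ht 2).div (hd ht 0) (h0 ht)).sub
    (((hd ht 1).div (hd ht 0) (h0 ht)).pow 2)
  rw [mu3Fun, hev.deriv_eq, hder.deriv]
  have := h0 ht
  norm_num [Pi.div_apply]
  field_simp
  ring

end RawMoments

lemma scaledMoment_eq_rawMoment {p : ℝ → ℝ}
    (hint : ∀ t > 0, ∀ j : ℕ, Integrable fun z => z ^ j * (exp (t * z) * p z))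
    (g h e : ℝ → ℝ) (j : ℕ) {x : ℝ} (hx : 0 < h x) :
    scaledMoment p g h e j x = (tiltScale h e x)⁻¹ * exp (g x - h x * x) *
      ((tiltScale h e x)⁻¹ ^ j * ∑ k ∈ Finset.range (j + 1),
        (-x) ^ (j - k) * j.choose k * rawMoment p k (h x)) := by
  rw [scaledMoment, mul_assoc]
  congr 1
  have hsum : ∀ z, ((z - x) / tiltScale h e x) ^ j * (exp (h x * (z - x) + g x) * p z) =
      ∑ k ∈ Finset.range (j + 1), exp (g x - h x * x) * (tiltScale h e x)⁻¹ ^ j *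
        ((-x) ^ (j - k) * j.choose k) * (z ^ k * (exp (h x * z) * p z)) := fun z => by
    rw [show h x * (z - x) + g x = (g x - h x * x) + h x * z by ring, exp_add, div_eq_mul_inv,
      mul_pow, sub_eq_add_neg z x, add_pow, Finset.sum_mul, Finset.sum_mul]
    refine Finset.sum_congr rfl fun k _ => ?_
    ring
  simp only [hsum]
  rw [integral_finsetSum _ fun k _ => (hint _ hx k).const_mul _, Finset.mul_sum, Finset.mul_sum]
  refine Finset.sum_congr rfl fun k _ => ?_
  rw [integral_const_mul, rawMoment]
  ring

/-- The skewness of the tilted density, computed at the tilt with mode `x`. -/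
lemma RegularGrowth.tendsto_skewness_comp {p g q h e e' : ℝ → ℝ} {c : ℝ}
    (H : RegularGrowth h e e') (hg : ∀ x, HasDerivAt g (h x) x)
    (hg0 : ∀ x ≥ 0, 0 < g x) (hc : 0 < c)
    (hpdef : ∀ x ≥ (0 : ℝ), p x = c * exp (-(g x - q x))) (hpzero : ∀ x < (0 : ℝ), p x = 0)
    (hint : ∀ t > 0, Integrable fun z => exp (t * z) * p z) (hq : Tendsto q atTop (𝓝 0)) :
    Tendsto (fun x => mu3Fun p (h x) / √(s2Fun p (h x)) ^ 3) atTop (𝓝 0) := by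
  have hpos : ∀ z ≥ 0, 0 < p z := fun z hz => by rw [hpdef z hz]; positivity
  have hp0 : ∀ z, 0 ≤ p z := fun z => by
    rcases lt_or_ge z 0 with hz | hz
    · exact (hpzero z hz).ge
    · exact (hpos z hz).le
  have hint' := integrable_pow_mul_exp_mul_density hp0 hint
  have hN := fun j => H.tendsto_scaledMoment hg hg0 hc hpdef hpzero hint' hq j
  set N := scaledMoment p g h e
  have hG0 := integral_pow_mul_exp_neg_sq_pos hc (j := 0) (by decide)
  have hG2 := integral_pow_mul_exp_neg_sq_pos hc (j := 2) (by decide)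
  have hN1 := hN 1
  have hN3 := hN 3
  rw [integral_pow_mul_exp_neg_sq_eq_zero c (by decide)] at hN1 hN3
  have r1 := hN1.div (hN 0) hG0.ne'
  have r2 := (hN 2).div (hN 0) hG0.ne'
  have r3 := hN3.div (hN 0) hG0.ne'
  set G0 := ∫ y : ℝ, c * (y ^ 0 * exp (-(y ^ 2 / 2)))
  set G2 := ∫ y : ℝ, c * (y ^ 2 * exp (-(y ^ 2 / 2)))
  have hlim := ((r3.sub ((r2.const_mul 3).mul r1)).add ((r1.pow 3).const_mul 2)).div
    (((continuous_sqrt.tendsto _).comp (r2.sub (r1.pow 2))).pow 3) (by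
      rw [zero_div, zero_pow two_ne_zero, sub_zero]; positivity)
  simp only [zero_div, mul_zero, sub_zero, add_zero, zero_pow three_ne_zero] at hlim
  refine hlim.congr' ?_
  filter_upwards [(hN 0).eventually_ne hG0.ne', H.tiltScale_pos, H.eventually_pos]
    with x hx hs ⟨_, ht, _⟩
  obtain ⟨e2, e3⟩ := cumulants_eq hp0 hpos hpzero hint ht
  have hM0 := rawMoment_zero_pos hp0 hpos hint ht
  have n := fun j => scaledMoment_eq_rawMoment hint' g h e j ht
  have hA := exp_pos (g x - h x * x)
  have f2 : s2Fun p (h x) = tiltScale h e x ^ 2 * (N 2 x / N 0 x - (N 1 x / N 0 x) ^ 2) := by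
    rw [e2]
    simp only [N, n, Finset.sum_range_succ, Finset.sum_range_zero]
    norm_num [Nat.choose]
    field_simp
    ring
  have f3 : mu3Fun p (h x) = tiltScale h e x ^ 3 *
      (N 3 x / N 0 x - 3 * (N 2 x / N 0 x) * (N 1 x / N 0 x) + 2 * (N 1 x / N 0 x) ^ 3) := by
    rw [e3]
    simp only [N, n, Finset.sum_range_succ, Finset.sum_range_zero]
    norm_num [Nat.choose]
    field_simp
    ring
  rw [f2, f3, Real.sqrt_mul (by positivity), Real.sqrt_sq hs.le, mul_pow,
    mul_div_mul_left _ _ (by positivity)]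
  rfl

lemma RegularGrowth.tendsto_of_tendsto_comp {h e e' f : ℝ → ℝ} (H : RegularGrowth h e e')
    {l : Filter ℝ} (hf : Tendsto (fun x => f (h x)) atTop l) : Tendsto f atTop l := by
  obtain ⟨X, hX⟩ := eventually_atTop.1 H.hasDerivAt_h
  intro s hs
  obtain ⟨Y, hY⟩ := mem_atTop_sets.1 (hf hs)
  have hcont : ContinuousOn h (Ici (max X Y)) := fun x hx =>
    (hX x ((le_max_left _ _).trans hx)).continuousAt.continuousWithinAt
  refine mem_atTop_sets.2 ⟨h (max X Y), fun t ht => ?_⟩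
  obtain ⟨b, hbt, hb⟩ := ((H.tendsto_h.eventually_ge_atTop t).and
    (eventually_ge_atTop (max X Y))).exists
  obtain ⟨x, hx, rfl⟩ := intermediate_value_Icc hb (hcont.mono Icc_subset_Ici_self) ⟨ht, hbt⟩
  exact hY x ((le_max_right _ _).trans hx.1)

lemma tendsto_atTop_of_superlinear_primitive {g h : ℝ → ℝ} (hg : ∀ x, HasDerivAt g (h x) x)
    (hglim : Tendsto (fun x => g x / x) atTop atTop) {X : ℝ} (hm : MonotoneOn h (Ici X)) :
    Tendsto h atTop atTop := by
  have hlow : Tendsto (fun x => g x / x + -(g (max X 1) / x)) atTop atTop :=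
    hglim.atTop_add (tendsto_const_nhds.div_atTop tendsto_id).neg
  refine tendsto_atTop_mono' _ ?_ hlow
  filter_upwards [hlow.eventually_ge_atTop 0, eventually_gt_atTop (max X 1)] with x hx0 hx
  have h1 : 1 ≤ max X 1 := le_max_right _ _
  have hpos : 0 < x := by linarith
  have hlow_eq : g x / x + -(g (max X 1) / x) = (g x - g (max X 1)) / x := by ring
  rw [hlow_eq, le_div_iff₀ hpos, zero_mul] at hx0
  rw [hlow_eq]
  obtain ⟨ξ, ⟨hξ1, hξ2⟩, hξ⟩ := exists_hasDerivAt_eq_slope g h hx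
    (fun y _ => (hg y).continuousAt.continuousWithinAt) fun y _ => hg y
  calc (g x - g (max X 1)) / x ≤ (g x - g (max X 1)) / (x - max X 1) :=
        div_le_div_of_nonneg_left hx0 (by linarith) (by linarith)
    _ = h ξ := hξ.symm
    _ ≤ h x := hm ((le_max_left _ _).trans hξ1.le) ((le_max_left _ _).trans hx.le) hξ2.le

lemma hasDerivAt_integral_div {ε : ℝ → ℝ} (hε : Continuous ε) {x : ℝ} (hx : 1 < x) :
    HasDerivAt (fun x => ∫ u in (1 : ℝ)..x, ε u / u) (ε x / x) x := by
  have hcont : ContinuousOn (fun u => ε u / u) (Ioi 0) :=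
    hε.continuousOn.div continuousOn_id fun u hu => ne_of_gt hu
  refine intervalIntegral.integral_hasDerivAt_right ?_ ?_
    (hcont.continuousAt (Ioi_mem_nhds (by linarith)))
  · refine (hcont.mono fun u hu => ?_).intervalIntegrable
    rw [uIcc_of_le hx.le] at hu
    exact lt_of_lt_of_le one_pos hu.1
  · exact hcont.stronglyMeasurableAtFilter isOpen_Ioi x (by simp only [mem_Ioi]; linarith)


lemma MemRbeta.exists_regularGrowth {g h : ℝ → ℝ} {β : ℝ} (hg : ∀ x, HasDerivAt g (h x) x)
    (hglim : Tendsto (fun x => g x / x) atTop atTop) (hh : MemRbeta h β) :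
    ∃ e e', RegularGrowth h e e' := by
  obtain ⟨hβ, l, ε, ε', ε'', ⟨dε, -, limε, hl⟩, hhl, ⟨C, hC⟩, -⟩ := hh
  have hεc : Continuous ε := continuous_iff_continuousAt.2 fun x => (dε x).continuousAt
  have hpos : ∀ᶠ x in atTop, β / 2 < β + ε x := by
    filter_upwards [limε.eventually_const_lt (show -(β / 2) < 0 by linarith)] with x hx
    linarith
  have hdh : ∀ᶠ x in atTop, 0 < h x ∧ HasDerivAt h (h x / (x * (β + ε x)⁻¹)) x := by
    obtain ⟨X, hX⟩ := eventually_atTop.1 hhl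
    filter_upwards [eventually_gt_atTop X, eventually_gt_atTop 1, hpos] with x hxX hx1 hβx
    have heq : h =ᶠ[𝓝 x] fun x => x ^ β * exp (∫ u in (1 : ℝ)..x, ε u / u) := by
      filter_upwards [Ioi_mem_nhds hxX, Ioi_mem_nhds hx1] with y hy hy1
      rw [hX y (le_of_lt hy), hl y (le_of_lt hy1)]
    have hx0 : 0 < x := by linarith
    have hI := hasDerivAt_integral_div hεc hx1
    have := (((hasDerivAt_id x).rpow_const (p := β) (Or.inl hx0.ne')).mul hI.exp)
    have hhx := heq.self_of_nhds
    refine ⟨by rw [hhx]; positivity, (this.congr_of_eventuallyEq heq).congr_deriv ?_⟩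
    rw [hhx]
    simp only [id, rpow_sub_one hx0.ne']
    field_simp
  have hh_top : Tendsto h atTop atTop := by
    obtain ⟨X, hX⟩ := eventually_atTop.1 (hdh.and (hpos.and (eventually_gt_atTop 0)))
    refine tendsto_atTop_of_superlinear_primitive hg hglim (X := X) ?_
    refine monotoneOn_of_deriv_nonneg (convex_Ici _)
      (fun x hx => (hX x hx).1.2.continuousAt.continuousWithinAt)
      (fun x hx => (hX x (interior_subset hx)).1.2.differentiableAt.differentiableWithinAt)
      fun x hx => ?_
    obtain ⟨⟨h1, h2⟩, h3, h4⟩ := hX x (interior_subset hx)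
    have : 0 < β + ε x := by linarith
    rw [h2.deriv]; positivity
  have hsum : Tendsto (fun x => β + ε x) atTop (𝓝 β) := by simpa using limε.const_add β
  have hinv : Tendsto (fun x => (β + ε x)⁻¹) atTop (𝓝 β⁻¹) := hsum.inv₀ hβ.ne'
  have hxh : Tendsto (fun x => x * h x) atTop atTop := tendsto_id.atTop_mul_atTop₀ hh_top
  refine ⟨fun x => (β + ε x)⁻¹, fun x => -ε' x / (β + ε x) ^ 2, ?_, hdh.mono fun x hx => hx.2,
    ?_, ⟨C / (β / 2) ^ 2, ?_⟩, hh_top, hxh.atTop_mul_pos (inv_pos.2 hβ) hinv, ?_⟩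
  · filter_upwards [hpos] with x hx
    have : 0 < β + ε x := by linarith
    positivity
  · filter_upwards [hpos] with x hx
    exact ((dε x).const_add β).inv (by linarith : 0 < β + ε x).ne'
  · filter_upwards [hpos, hC, eventually_gt_atTop 0] with x hx hCx hx0
    rw [neg_div, mul_neg, abs_neg, mul_div_assoc', abs_div, abs_mul, abs_of_pos hx0,
      abs_of_pos (pow_pos (by linarith : 0 < β + ε x) 2)]
    have : 0 ≤ x * |ε' x| := by positivity
    gcongr
    linarith
  · simp only [div_inv_eq_mul]
    exact hxh.atTop_mul_pos hβ hsum

lemma MemRinfty.exists_regularGrowth {g h : ℝ → ℝ} (hg : ∀ x, HasDerivAt g (h x) x)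
    (hglim : Tendsto (fun x => g x / x) atTop atTop) (hh : MemRinfty h) :
    ∃ e e', RegularGrowth h e e' := by
  obtain ⟨hmono, ε, ε', ε'', dε, -, hψ, -, hε', -, η, ⟨hη0, hη1⟩, c, hc, hcε⟩ := hh
  have hεc : Continuous ε := continuous_iff_continuousAt.2 fun x => (dε x).continuousAt
  have hh_top : Tendsto h atTop atTop :=
    tendsto_atTop_of_superlinear_primitive hg hglim hmono.monotoneOn
  have hεpos : ∀ᶠ u in atTop, 0 < ε u := by
    filter_upwards [hcε, eventually_gt_atTop 0] with u hu hu0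
    exact pos_of_mul_pos_right (hc.trans_le hu) (by positivity)
  have hε_le : ∃ K > 0, ∀ᶠ u in atTop, ε u ≤ K * u := by
    obtain ⟨U, hU⟩ := eventually_atTop.1 ((hε'.eventually_le_const one_pos).and
      (hεpos.and (eventually_gt_atTop 0)))
    have hanti : AntitoneOn (fun u => ε u / u) (Ici U) := by
      have hd : ∀ u ∈ Ici U, HasDerivAt (fun u => ε u / u) ((ε' u * u - ε u) / u ^ 2) u :=
        fun u hu => ((dε u).div (hasDerivAt_id u) (hU u hu).2.2.ne').congr_deriv (by simp)
      refine antitoneOn_of_deriv_nonpos (convex_Ici _)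
        (fun u hu => (hd u hu).continuousAt.continuousWithinAt)
        (fun u hu => (hd u (interior_subset hu)).differentiableAt.differentiableWithinAt)
        fun u hu => ?_
      obtain ⟨h1, h2, h3⟩ := hU u (interior_subset hu)
      rw [(hd u (interior_subset hu)).deriv]
      rw [div_le_one h2] at h1
      exact div_nonpos_of_nonpos_of_nonneg (by linarith) (by positivity)
    refine ⟨ε U / U, div_pos (hU U le_rfl).2.1 (hU U le_rfl).2.2, ?_⟩
    filter_upwards [eventually_ge_atTop U] with u hu
    have := hanti (mem_Ici.2 le_rfl) hu hu
    rwa [div_le_iff₀ (hU u hu).2.2] at this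
  obtain ⟨K, hK, hεK⟩ := hε_le
  have hinv : ∀ x > 0, 1 ≤ h x → geninv h (h x) = x := by
    intro x hx hx1
    have hpos : 0 < geninv h (h x) := by rw [hψ _ hx1]; exact exp_pos _
    have hbdd : BddBelow {z : ℝ | h x ≤ h z} := by
      by_contra hb
      rw [geninv, Real.sInf_of_not_bddBelow hb] at hpos
      exact hpos.false
    have hset : {z : ℝ | h x ≤ h z} = Ici x := by
      ext z
      constructor
      · intro hz
        have hz0 : 0 < z := hpos.trans_le (csInf_le hbdd hz)
        exact (hmono.le_iff_le hx.le hz0.le).1 hz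
      · intro hz
        exact (hmono.le_iff_le hx.le (hx.le.trans hz)).2 hz
    rw [geninv, hset, csInf_Ici]
  have hcont : ∀ x > 0, ContinuousAt h x := fun x hx => by
    refine continuousAt_of_monotoneOn_of_image_mem_nhds hmono.monotoneOn (Ici_mem_nhds hx) ?_
    have hord : (h '' Ici 0).OrdConnected :=
      ordConnected_Ici.image_hasDerivWithinAt fun y _ => (hg y).hasDerivWithinAt
    have h1 : h (x / 2) < h x := hmono (by simp; linarith) hx.le (by linarith)
    have h2 : h x < h (x + 1) := hmono hx.le (by simp; linarith) (by linarith)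
    exact mem_of_superset (Icc_mem_nhds h1 h2) (hord.out
      (mem_image_of_mem _ (by simp; linarith)) (mem_image_of_mem _ (by simp; linarith)))
  have hdh : ∀ᶠ x in atTop, HasDerivAt h (h x / (x * ε (h x))) x := by
    filter_upwards [eventually_gt_atTop 0, hh_top.eventually_gt_atTop 1,
      hh_top.eventually hεpos] with x hx hx1 hεx
    have hnear : ∀ᶠ y in 𝓝 x, geninv h (h y) = y := by
      filter_upwards [Ioi_mem_nhds hx, (hcont x hx).eventually (Ioi_mem_nhds hx1)] with y hy hy1
      exact hinv y hy (le_of_lt hy1)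
    have hψx := hinv x hx hx1.le
    have hdψ : HasDerivAt (geninv h) (x * (ε (h x) / h x)) (h x) := by
      have heq : geninv h =ᶠ[𝓝 (h x)] fun u => exp (∫ v in (1 : ℝ)..u, ε v / v) := by
        filter_upwards [Ioi_mem_nhds hx1] with u hu using hψ u (le_of_lt hu)
      have := (hasDerivAt_integral_div hεc hx1).exp.congr_of_eventuallyEq heq
      rwa [← hψ _ hx1.le, hψx] at this
    have hhx : 0 < h x := by linarith
    refine (hdψ.of_local_left_inverse (hcont x hx) (by positivity) hnear).congr_deriv ?_
    field_simp
  refine ⟨fun x => ε (h x), fun x => ε' (h x) * (h x / (x * ε (h x))),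
    hh_top.eventually hεpos, hdh, hdh.mono fun x hx => (dε (h x)).comp x hx, ⟨1, ?_⟩,
    hh_top, ?_, ?_⟩
  · have := (hε'.comp hh_top).eventually (Metric.closedBall_mem_nhds 0 one_pos)
    filter_upwards [this, eventually_gt_atTop 0, hh_top.eventually hεpos] with x hx hx0 hεx
    rw [dist_zero_right, Real.norm_eq_abs] at hx
    refine le_of_eq_of_le ?_ hx
    congr 1
    simp only [Function.comp]
    field_simp
  · refine tendsto_atTop_mono' _ ?_ (tendsto_id.const_mul_atTop hc)
    filter_upwards [eventually_gt_atTop 0, hh_top.eventually_ge_atTop 1,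
      hh_top.eventually hcε, hh_top.eventually hεpos] with x hx hx1 hcx hεx
    have : h x ^ η ≤ h x := by
      simpa using rpow_le_rpow_of_exponent_le hx1 (by linarith : η ≤ 1)
    calc c * x ≤ h x ^ η * ε (h x) * x := by gcongr
      _ ≤ h x * ε (h x) * x := by gcongr
      _ = x * h x * ε (h x) := by ring
  · refine tendsto_atTop_mono' _ ?_ (tendsto_id.atTop_div_const hK)
    filter_upwards [eventually_gt_atTop 0, hh_top.eventually hεK, hh_top.eventually hεpos]
      with x hx hKx hεx
    simp only [id]
    rw [div_le_div_iff₀ hK hεx]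
    calc x * ε (h x) ≤ x * (K * h x) := by gcongr
      _ = x * h x * K := by ring

/-- As `t → ∞`, `μ₃ t / s t ^ 3 → 0`: the skewness of the tilted
density tends to zero. -/
theorem tilted_skewness_tendsto_zero
    (p g q h : ℝ → ℝ) (c : ℝ) (hc : 0 < c)
    (hpdef : ∀ x ≥ (0:ℝ), p x = c * Real.exp (-(g x - q x)))
    (hpzero : ∀ x < (0:ℝ), p x = 0)
    (hpdens : (∫ x in Set.Ici (0:ℝ), p x) = 1)
    (hgpos : ∀ x ≥ (0:ℝ), 0 < g x)
    (hglim : Tendsto (fun x => g x / x) atTop atTop)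
    (hgderiv : ∀ x, HasDerivAt g (h x) x)
    (hq : ∃ ϑ > (0:ℝ), ∀ᶠ x in atTop, ∀ v, |v - x| < ϑ * x → |q v| ≤ 1 / Real.sqrt (x * h x))
    (hmem : MemFrakR h)
    (hPhi : ∀ t > (0:ℝ), IntegrableOn (fun x => Real.exp (t * x) * p x) (Set.Ici 0))
    :
    Tendsto (fun t => mu3Fun p t / Real.sqrt (s2Fun p t) ^ 3) atTop (𝓝 0) := by
  obtain ⟨e, e', H⟩ : ∃ e e', RegularGrowth h e e' := by
    rcases hmem with ⟨β, hβ⟩ | hinf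
    · exact hβ.exists_regularGrowth hgderiv hglim
    · exact hinf.exists_regularGrowth hgderiv hglim
  have hq0 : Tendsto q atTop (𝓝 0) := by
    obtain ⟨ϑ, hϑ, hqϑ⟩ := hq
    refine squeeze_zero_norm' ?_ (tendsto_inv_sqrt_atTop H.tendsto_id_mul)
    filter_upwards [hqϑ, eventually_gt_atTop 0] with x hx hx0
    simpa using hx x (by simpa using mul_pos hϑ hx0)
  have hint : ∀ t > 0, Integrable fun z => exp (t * z) * p z := fun t ht =>
    (integrableOn_iff_integrable_of_support_subset fun z hz => by
      by_contra hz0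
      exact hz (by simp [hpzero z (by simpa using hz0)])).1 (hPhi t ht)
  exact H.tendsto_of_tendsto_comp (f := fun t => mu3Fun p t / √(s2Fun p t) ^ 3)
    (H.tendsto_skewness_comp hgderiv hgpos hc hpdef hpzero hint hq0)
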